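/- Let d ∈ {1,2,3}, let Ω ⊆ ℝ^d be a nonempty bounded open set, let b, c > 0 and k, σ ∈ ℝ. If ψ is admissible and solves the Blackstock equation ψ_tt − c²(1 − 2k ψ_t)Δψ − b Δψ_t + 2σ ∇ψ·∇ψ_t = 0 on an open time interval I × Ω, then for every t ∈ I the function E₁(t) := ½∫_Ω ψ_t(t)² + (c²/2)∫_Ω |∇ψ(t)|² is differentiable in t and satisfies E₁′(t) + b ∫_Ω |∇ψ_t(t)|² = ∫_Ω f(t) ψ_t(t), where f := −2k c² ψ_t Δψ − 2σ ∇ψ·∇ψ_t. -/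

import Mathlib

open MeasureTheory Real

noncomputable section

/-- Euclidean space ℝ^d. -/
abbrev Spc (d : ℕ) := EuclideanSpace ℝ (Fin d)

variable {d : ℕ}

/-- Spatial Laplacian: sum of second derivatives in the coordinate directions. -/
def lap (g : Spc d → ℝ) (x : Spc d) : ℝ :=
  ∑ i, fderiv ℝ (fun y => fderiv ℝ g y (EuclideanSpace.single i 1)) x (EuclideanSpace.single i 1)

/-- Squared L²(Ω) norm: ‖g‖² = ∫_Ω g². -/
def sqL2 (Ω : Set (Spc d)) (g : Spc d → ℝ) : ℝ := ∫ x in Ω, (g x) ^ 2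

/-- Squared L²(Ω) norm of the gradient: ‖∇g‖² = ∫_Ω |∇g|². -/
def sqGrad (Ω : Set (Spc d)) (g : Spc d → ℝ) : ℝ := ∫ x in Ω, ‖gradient g x‖ ^ 2

/-- Squared L²(Ω) norm of the Hessian: ‖D²g‖² = ∫_Ω |D²g|². -/
def sqHess (Ω : Set (Spc d)) (g : Spc d → ℝ) : ℝ := ∫ x in Ω, ‖iteratedFDeriv ℝ 2 g x‖ ^ 2

/-- Squared H¹(Ω) norm. -/
def sqH1 (Ω : Set (Spc d)) (g : Spc d → ℝ) : ℝ := sqL2 Ω g + sqGrad Ω g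

/-- Squared H²(Ω) norm. -/
def sqH2 (Ω : Set (Spc d)) (g : Spc d → ℝ) : ℝ := sqL2 Ω g + sqGrad Ω g + sqHess Ω g

/-- H⁻¹(Ω) norm by duality against smooth compactly supported test functions. -/
def negH1 (Ω : Set (Spc d)) (g : Spc d → ℝ) : ℝ :=
  sSup { r : ℝ | ∃ φ : Spc d → ℝ, ContDiff ℝ (⊤ : ℕ∞) φ ∧ HasCompactSupport φ ∧ tsupport φ ⊆ Ω ∧
      (∫ x in Ω, ‖gradient φ x‖ ^ 2) ≤ 1 ∧ r = ∫ x in Ω, g x * φ x }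

/-- Admissible: smooth in (t,x), with spatial support in a fixed compact subset of Ω. -/
def Admissible (Ω : Set (Spc d)) (w : ℝ → Spc d → ℝ) : Prop :=
  ContDiff ℝ (⊤ : ℕ∞) (fun p : ℝ × Spc d => w p.1 p.2) ∧
  ∃ K : Set (Spc d), IsCompact K ∧ K ⊆ Ω ∧ ∀ t, Function.support (w t) ⊆ K

/-- Inner product of two spatial gradients: ∇g·∇h. -/
def gdot (g h : Spc d → ℝ) (x : Spc d) : ℝ := @inner ℝ _ _ (gradient g x) (gradient h x)

/-- Time derivative. -/
def tderiv (w : ℝ → Spc d → ℝ) (t : ℝ) (x : Spc d) : ℝ := deriv (fun s => w s x) t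

/-- The Blackstock equation ψ_tt − c²(1 − 2k ψ_t)Δψ − b Δψ_t + 2σ ∇ψ·∇ψ_t = 0
holds at time `t` on `Ω`. -/
def IsBlackstock (Ω : Set (Spc d)) (b c k σ : ℝ) (ψ : ℝ → Spc d → ℝ) (t : ℝ) : Prop :=
  ∀ x ∈ Ω,
    (tderiv (tderiv ψ) t x - c ^ 2 * (1 - 2 * k * tderiv ψ t x) * lap (ψ t) x
      - b * lap (tderiv ψ t) x
      + 2 * σ * gdot (ψ t) (tderiv ψ t) x) = 0

/-- Energy E(t). -/
def energy (Ω : Set (Spc d)) (b c : ℝ) (ψ : ℝ → Spc d → ℝ) (t : ℝ) : ℝ :=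
  (1 / 2) * sqL2 Ω (tderiv ψ t) + (c ^ 2 / 2) * sqGrad Ω (ψ t)
    + (c ^ 2 / (2 * b)) * sqL2 Ω (lap (ψ t)) + sqGrad Ω (tderiv ψ t)

/-- Dissipation D(t). -/
def dissip (Ω : Set (Spc d)) (ψ : ℝ → Spc d → ℝ) (t : ℝ) : ℝ :=
  ∫ s in (0:ℝ)..t,
    (sqGrad Ω (tderiv ψ s) + sqL2 Ω (lap (tderiv ψ s)) + sqGrad Ω (ψ s)
      + sqL2 Ω (lap (ψ s)) + sqL2 Ω (tderiv (tderiv ψ) s))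

/-- Supremum of a function of time over [0,T]. -/
def supIcc (T : ℝ) (f : ℝ → ℝ) : ℝ := ⨆ t : Set.Icc (0:ℝ) T, f t

/-- f := −2k c² ψ_t Δψ − 2σ ∇ψ·∇ψ_t, the right-hand side nonlinearity. -/
def blackF (c k σ : ℝ) (ψ : ℝ → Spc d → ℝ) (t : ℝ) (x : Spc d) : ℝ :=
  -(2 * k * c ^ 2) * tderiv ψ t x * lap (ψ t) x - 2 * σ * gdot (ψ t) (tderiv ψ t) x

/-- The nonlocal heat equation v_t − b Δv − c² Δψ = f (with v = ψ_t) holds at time `t` on `Ω`. -/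
def IsHeat (Ω : Set (Spc d)) (b c : ℝ) (ψ f : ℝ → Spc d → ℝ) (t : ℝ) : Prop :=
  ∀ x ∈ Ω,
    tderiv (tderiv ψ) t x - b * lap (tderiv ψ t) x - c ^ 2 * lap (ψ t) x = f t x

/-- The linearized Blackstock equation
ψ_tt − c²(1 − 2k α)Δψ − b Δψ_t + 2σ ∇ψ·∇α = f̃ holds at time `t` on `Ω`. -/
def IsLinBlackstock (Ω : Set (Spc d)) (b c k σ : ℝ) (α ψ f : ℝ → Spc d → ℝ) (t : ℝ) : Prop :=
  ∀ x ∈ Ω,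
    tderiv (tderiv ψ) t x - c ^ 2 * (1 - 2 * k * α t x) * lap (ψ t) x
      - b * lap (tderiv ψ t) x + 2 * σ * gdot (ψ t) (α t) x = f t x

/-- Time-weighted norm N_T^v for the velocity variable. -/
def normV (Ω : Set (Spc d)) (T : ℝ) (α : ℝ → Spc d → ℝ) : ℝ :=
  supIcc T (fun t => Real.sqrt (sqH1 Ω (α t)))
    + Real.sqrt (∫ t in (0:ℝ)..T, (sqL2 Ω (α t) + sqGrad Ω (α t) + sqL2 Ω (lap (α t))))
    + Real.sqrt (∫ t in (0:ℝ)..T, sqL2 Ω (tderiv α t))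
    + supIcc T (fun t => Real.sqrt t * Real.sqrt (sqL2 Ω (tderiv α t)))
    + Real.sqrt (∫ t in (0:ℝ)..T, t * sqGrad Ω (tderiv α t))
    + supIcc T (fun t => Real.sqrt t * Real.sqrt (sqL2 Ω (lap (α t))))

/-- Time-weighted solution norm N_T(ψ) = sup_{[0,T]} ‖ψ(t)‖_{H²} + N_T^v(ψ_t). -/
def normX (Ω : Set (Spc d)) (T : ℝ) (ψ : ℝ → Spc d → ℝ) : ℝ :=
  supIcc T (fun t => Real.sqrt (sqH2 Ω (ψ t))) + normV Ω T (tderiv ψ)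

/-- Spatial partial derivative. -/
def xd (i : Fin d) (w : ℝ → Spc d → ℝ) (t : ℝ) (x : Spc d) : ℝ :=
  fderiv ℝ (w t) x (EuclideanSpace.single i 1)

lemma smooth_hasFDerivAt {w : ℝ → Spc d → ℝ}
    (h : ContDiff ℝ (⊤ : ℕ∞) (fun p : ℝ × Spc d => w p.1 p.2)) (t : ℝ) (x : Spc d) :
    HasFDerivAt (fun p : ℝ × Spc d => w p.1 p.2)
      (fderiv ℝ (fun p : ℝ × Spc d => w p.1 p.2) (t, x)) (t, x) :=
  ((h.differentiable (by simp)) (t, x)).hasFDerivAt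

lemma smooth_hasDerivAt {w : ℝ → Spc d → ℝ}
    (h : ContDiff ℝ (⊤ : ℕ∞) (fun p : ℝ × Spc d => w p.1 p.2)) (t : ℝ) (x : Spc d) :
    HasDerivAt (fun s => w s x)
      (fderiv ℝ (fun p : ℝ × Spc d => w p.1 p.2) (t, x) (1, 0)) t := by
  have h2 : HasDerivAt (fun s : ℝ => ((s, x) : ℝ × Spc d)) (1, 0) t :=
    (hasDerivAt_id t).prodMk (hasDerivAt_const t x)
  exact (smooth_hasFDerivAt h t x).comp_hasDerivAt t h2

lemma smooth_hasDerivAt' {w : ℝ → Spc d → ℝ}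
    (h : ContDiff ℝ (⊤ : ℕ∞) (fun p : ℝ × Spc d => w p.1 p.2)) (t : ℝ) (x : Spc d) :
    HasDerivAt (fun s => w s x) (tderiv w t x) t :=
  (smooth_hasDerivAt h t x).differentiableAt.hasDerivAt

lemma tderiv_eq {w : ℝ → Spc d → ℝ}
    (h : ContDiff ℝ (⊤ : ℕ∞) (fun p : ℝ × Spc d => w p.1 p.2)) (t : ℝ) (x : Spc d) :
    tderiv w t x = fderiv ℝ (fun p : ℝ × Spc d => w p.1 p.2) (t, x) (1, 0) :=
  (smooth_hasDerivAt h t x).deriv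

lemma slice_smooth {w : ℝ → Spc d → ℝ}
    (h : ContDiff ℝ (⊤ : ℕ∞) (fun p : ℝ × Spc d => w p.1 p.2)) (t : ℝ) :
    ContDiff ℝ (⊤ : ℕ∞) (w t) :=
  h.comp (contDiff_const.prodMk contDiff_id)

lemma slice_diff {w : ℝ → Spc d → ℝ}
    (h : ContDiff ℝ (⊤ : ℕ∞) (fun p : ℝ × Spc d => w p.1 p.2)) (t : ℝ) (x : Spc d) :
    DifferentiableAt ℝ (w t) x :=
  ((slice_smooth h t).differentiable (by simp)) x

lemma xd_eq {w : ℝ → Spc d → ℝ}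
    (h : ContDiff ℝ (⊤ : ℕ∞) (fun p : ℝ × Spc d => w p.1 p.2)) (i : Fin d) (t : ℝ) (x : Spc d) :
    xd i w t x = fderiv ℝ (fun p : ℝ × Spc d => w p.1 p.2) (t, x)
      (0, EuclideanSpace.single i 1) := by
  have h2 : HasFDerivAt (fun y : Spc d => ((t, y) : ℝ × Spc d))
      (ContinuousLinearMap.inr ℝ ℝ (Spc d)) x := hasFDerivAt_prodMk_right t x
  have h3 : HasFDerivAt (w t) _ x := (smooth_hasFDerivAt h t x).comp x h2
  unfold xd
  rw [h3.fderiv]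
  simp

lemma smooth_dir {w : ℝ → Spc d → ℝ}
    (h : ContDiff ℝ (⊤ : ℕ∞) (fun p : ℝ × Spc d => w p.1 p.2)) (v : ℝ × Spc d) :
    ContDiff ℝ (⊤ : ℕ∞) (fun q => fderiv ℝ (fun p : ℝ × Spc d => w p.1 p.2) q v) :=
  (h.fderiv_right (by simp)).clm_apply contDiff_const

lemma Admissible.tderiv {Ω : Set (Spc d)} {w : ℝ → Spc d → ℝ} (h : Admissible Ω w) :
    Admissible Ω (tderiv w) := by
  obtain ⟨h, K, hK, hKΩ, hs⟩ := h
  refine ⟨?_, K, hK, hKΩ, ?_⟩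
  · convert smooth_dir h (1, 0) using 2 with p
    exact tderiv_eq h p.1 p.2
  · intro t x hx
    by_contra hxK
    apply hx
    have : (fun s => w s x) = fun _ => 0 := by
      funext s
      by_contra h0
      exact hxK (hs s h0)
    simp [_root_.tderiv, this]

lemma Admissible.xd {Ω : Set (Spc d)} {w : ℝ → Spc d → ℝ} (h : Admissible Ω w) (i : Fin d) :
    Admissible Ω (xd i w) := by
  obtain ⟨h, K, hK, hKΩ, hs⟩ := h
  refine ⟨?_, K, hK, hKΩ, ?_⟩
  · convert smooth_dir h (0, EuclideanSpace.single i 1) using 2 with p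
    exact xd_eq h i p.1 p.2
  · intro t x hx
    by_contra hxK
    apply hx
    have : w t =ᶠ[nhds x] fun _ => 0 := by
      filter_upwards [hK.isClosed.isOpen_compl.mem_nhds hxK] with y hy
      by_contra h0
      exact hy (hs t h0)
    simp [_root_.xd, this.fderiv_eq]

lemma tderiv_xd {w : ℝ → Spc d → ℝ}
    (h : ContDiff ℝ (⊤ : ℕ∞) (fun p : ℝ × Spc d => w p.1 p.2)) (i : Fin d) (t : ℝ) (x : Spc d) :
    tderiv (xd i w) t x = xd i (tderiv w) t x := by
  set W := fun p : ℝ × Spc d => w p.1 p.2 with hW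
  have e1 : (fun p : ℝ × Spc d => xd i w p.1 p.2)
      = fun q => fderiv ℝ W q (0, EuclideanSpace.single i 1) := by
    funext p; exact xd_eq h i p.1 p.2
  have e2 : (fun p : ℝ × Spc d => tderiv w p.1 p.2) = fun q => fderiv ℝ W q (1, 0) := by
    funext p; exact tderiv_eq h p.1 p.2
  have hd : DifferentiableAt ℝ (fderiv ℝ W) (t, x) :=
    (h.fderiv_right (m := (⊤ : ℕ∞)) (by simp)).differentiable (by simp) _
  have key : ∀ u v : ℝ × Spc d, fderiv ℝ (fun q => fderiv ℝ W q u) (t, x) v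
      = fderiv ℝ (fderiv ℝ W) (t, x) v u := by
    intro u v
    have := hd.hasFDerivAt.clm_apply (hasFDerivAt_const u (t, x))
    rw [this.fderiv]
    simp
  rw [tderiv_eq (by rw [e1]; exact smooth_dir h _), e1,
    xd_eq (by rw [e2]; exact smooth_dir h _), e2, key, key]
  have hsym : IsSymmSndFDerivAt ℝ W (t, x) :=
    h.contDiffAt.isSymmSndFDerivAt (by
      simpa using WithTop.coe_le_coe.2 (le_top : (2 : ℕ∞) ≤ ⊤))
  exact hsym _ _

lemma Admissible.mul {Ω : Set (Spc d)} {u w : ℝ → Spc d → ℝ} (h : Admissible Ω u)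
    (h' : Admissible Ω w) : Admissible Ω (fun t x => u t x * w t x) := by
  obtain ⟨h, K, hK, hKΩ, hs⟩ := h
  refine ⟨h.mul h'.1, K, hK, hKΩ, fun t x hx => hs t (left_ne_zero_of_mul hx)⟩

lemma Admissible.cmul {Ω : Set (Spc d)} {w : ℝ → Spc d → ℝ} (a : ℝ)
    (h : Admissible Ω w) : Admissible Ω (fun t x => a * w t x) := by
  obtain ⟨h, K, hK, hKΩ, hs⟩ := h
  refine ⟨contDiff_const.mul h, K, hK, hKΩ, fun t x hx => hs t (right_ne_zero_of_mul hx)⟩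

lemma Admissible.add {Ω : Set (Spc d)} {u w : ℝ → Spc d → ℝ} (h : Admissible Ω u)
    (h' : Admissible Ω w) : Admissible Ω (fun t x => u t x + w t x) := by
  obtain ⟨h, K, hK, hKΩ, hs⟩ := h
  obtain ⟨h', K', hK', hKΩ', hs'⟩ := h'
  refine ⟨h.add h', K ∪ K', hK.union hK', Set.union_subset hKΩ hKΩ', fun t x hx => ?_⟩
  by_contra hn
  simp only [Set.mem_union, not_or] at hn
  apply hx
  have a1 : u t x = 0 := by by_contra h0; exact hn.1 (hs t h0)
  have a2 : w t x = 0 := by by_contra h0; exact hn.2 (hs' t h0)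
  simp [a1, a2]

lemma Admissible.zero {Ω : Set (Spc d)} : Admissible Ω (fun _ _ => 0) :=
  ⟨contDiff_const, ∅, isCompact_empty, Set.empty_subset _, fun t => by simp⟩

lemma Admissible.sum {Ω : Set (Spc d)} {ι : Type*} (s : Finset ι) {u : ι → ℝ → Spc d → ℝ}
    (h : ∀ i, Admissible Ω (u i)) : Admissible Ω (fun t x => ∑ i ∈ s, u i t x) := by
  classical
  induction s using Finset.induction_on with
  | empty => simpa using Admissible.zero
  | insert a s ha ih => simpa [Finset.sum_insert ha] using (h a).add ih

lemma Admissible.compactSupport {Ω : Set (Spc d)} {w : ℝ → Spc d → ℝ} (h : Admissible Ω w)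
    (t : ℝ) : HasCompactSupport (w t) := by
  obtain ⟨h, K, hK, hKΩ, hs⟩ := h
  exact HasCompactSupport.of_support_subset_isCompact hK (hs t)

lemma Admissible.integrable {Ω : Set (Spc d)} {w : ℝ → Spc d → ℝ} (h : Admissible Ω w)
    (t : ℝ) : Integrable (w t) :=
  (slice_smooth h.1 t).continuous.integrable_of_hasCompactSupport (h.compactSupport t)

lemma Admissible.setIntegral {Ω : Set (Spc d)} {w : ℝ → Spc d → ℝ} (h : Admissible Ω w)
    (t : ℝ) : ∫ x in Ω, w t x = ∫ x, w t x := by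
  obtain ⟨h, K, hK, hKΩ, hs⟩ := h
  apply setIntegral_eq_integral_of_forall_compl_eq_zero
  intro x hx
  by_contra h0
  exact hx (hKΩ (hs t h0))

lemma Admissible.integral_xd {Ω : Set (Spc d)} {w : ℝ → Spc d → ℝ} (h : Admissible Ω w)
    (i : Fin d) (t : ℝ) : ∫ x in Ω, _root_.xd i w t x = 0 := by
  rw [(h.xd i).setIntegral]
  have := integral_mul_fderiv_eq_neg_fderiv_mul_of_integrable (μ := (volume : Measure (Spc d)))
    (f := fun _ => (1 : ℝ)) (g := w t) (v := EuclideanSpace.single i (1 : ℝ))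
    (by simp) (by simp only [one_mul]; exact (h.xd i).integrable t) (by simpa using h.integrable t)
    (fun x _ => differentiableAt_const _) (fun x _ => slice_diff h.1 t x)
  simp only [one_mul, fderiv_fun_const, Pi.zero_apply, ContinuousLinearMap.zero_apply, zero_mul,
    integral_zero, neg_zero] at this
  exact this

lemma Admissible.hasDerivAt_integral {Ω : Set (Spc d)} {w : ℝ → Spc d → ℝ}
    (h : Admissible Ω w) (t : ℝ) :
    HasDerivAt (fun s => ∫ x in Ω, w s x) (∫ x in Ω, _root_.tderiv w t x) t := by
  have ht := h.tderiv
  obtain ⟨hc, K, hK, hKΩ, hs⟩ := h.tderiv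
  obtain ⟨C, hC⟩ := ((isCompact_Icc (a := t - 1) (b := t + 1)).prod hK).exists_bound_of_continuousOn
    hc.continuous.continuousOn
  have e1 : (fun s => ∫ x in Ω, w s x) = fun s => ∫ x, w s x := by
    funext s; exact h.setIntegral s
  rw [e1, ht.setIntegral]
  refine (hasDerivAt_integral_of_dominated_loc_of_deriv_le (F := w) (F' := _root_.tderiv w)
    (bound := K.indicator fun _ => C) (s := Set.Icc (t - 1) (t + 1))
    (Icc_mem_nhds (by linarith) (by linarith)) ?_ (h.integrable t) ?_ ?_ ?_ ?_).2
  · exact Filter.Eventually.of_forall fun s => (h.integrable s).aestronglyMeasurable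
  · exact (ht.integrable t).aestronglyMeasurable
  · refine Filter.Eventually.of_forall fun x s hsI => ?_
    by_cases hx : x ∈ K
    · simpa [hx] using hC (s, x) ⟨hsI, hx⟩
    · have : _root_.tderiv w s x = 0 := by by_contra h0; exact hx (hs s h0)
      simp [hx, this]
  · exact (integrable_indicator_iff hK.measurableSet).2
      (integrableOn_const hK.measure_lt_top.ne)
  · exact Filter.Eventually.of_forall fun x s _ => smooth_hasDerivAt' h.1 s x

lemma integral_lin {μ : Measure (Spc d)} (a e b : ℝ) {A B C D : Spc d → ℝ}
    (hA : Integrable A μ) (hB : Integrable B μ) (hC : Integrable C μ) (hD : Integrable D μ) :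
    ∫ x, ((a * A x + e * B x + b * C x) - D x) ∂μ
      = a * (∫ x, A x ∂μ) + e * (∫ x, B x ∂μ) + b * (∫ x, C x ∂μ) - ∫ x, D x ∂μ := by
  have h1 : Integrable (fun x => a * A x) μ := hA.const_mul a
  have h2 : Integrable (fun x => e * B x) μ := hB.const_mul e
  have h3 : Integrable (fun x => b * C x) μ := hC.const_mul b
  have h12 : Integrable (fun x => a * A x + e * B x) μ := h1.add h2
  have h123 : Integrable (fun x => a * A x + e * B x + b * C x) μ := h12.add h3
  rw [integral_sub h123 hD, integral_add h12 h3, integral_add h1 h2,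
    integral_const_mul, integral_const_mul, integral_const_mul]

lemma gdot_eq (g h : Spc d → ℝ) (x : Spc d) :
    gdot g h x = ∑ i, fderiv ℝ g x (EuclideanSpace.single i 1)
      * fderiv ℝ h x (EuclideanSpace.single i 1) := by
  have key : ∀ (g : Spc d → ℝ) (i : Fin d),
      inner ℝ (gradient g x) (EuclideanSpace.basisFun (Fin d) ℝ i)
        = fderiv ℝ g x (EuclideanSpace.single i 1) := by
    intro g i
    simp [gradient]
  unfold gdot
  rw [← (EuclideanSpace.basisFun (Fin d) ℝ).sum_inner_mul_inner]
  refine Finset.sum_congr rfl fun i _ => ?_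
  rw [key, real_inner_comm, key]

lemma normsq_gradient (g : Spc d → ℝ) (x : Spc d) :
    ‖gradient g x‖ ^ 2 = ∑ i, fderiv ℝ g x (EuclideanSpace.single i 1)
      * fderiv ℝ g x (EuclideanSpace.single i 1) := by
  rw [← gdot_eq, gdot, real_inner_self_eq_norm_sq]

/-- the energy identity E₁′(t) + b‖∇ψ_t‖² = ∫ f ψ_t
for solutions of the Blackstock equation. -/
theorem blackstock_E1_identity (d : ℕ) (hd : d = 1 ∨ d = 2 ∨ d = 3)
    (Ω : Set (Spc d)) (hne : Ω.Nonempty) (hop : IsOpen Ω) (hbd : Bornology.IsBounded Ω)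
    (b c k σ : ℝ) (hb : 0 < b) (hc : 0 < c)
    (I : Set ℝ) (hIo : IsOpen I) (hIc : I.OrdConnected)
    (ψ : ℝ → Spc d → ℝ) (hadm : Admissible Ω ψ)
    (hsol : ∀ t ∈ I, IsBlackstock Ω b c k σ ψ t) :
    ∀ t ∈ I,
      HasDerivAt (fun s => (1/2) * sqL2 Ω (tderiv ψ s) + (c ^ 2 / 2) * sqGrad Ω (ψ s))
        ((∫ x in Ω, blackF c k σ ψ t x * tderiv ψ t x) - b * sqGrad Ω (tderiv ψ t)) t := by
  intro t htI
  have hv := hadm.tderiv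
  -- squares
  have aV := hv.mul hv
  have aG : Admissible Ω (fun t x => ∑ i, xd i ψ t x * xd i ψ t x) :=
    Admissible.sum _ fun i => (hadm.xd i).mul (hadm.xd i)
  have aGv : Admissible Ω (fun t x => ∑ i, xd i (tderiv ψ) t x * xd i (tderiv ψ) t x) :=
    Admissible.sum _ fun i => (hv.xd i).mul (hv.xd i)
  have eG : ∀ s, sqGrad Ω (ψ s) = ∫ x in Ω, ∑ i, xd i ψ s x * xd i ψ s x := fun s => by
    simp only [sqGrad, normsq_gradient, xd]
  have eGv : sqGrad Ω (tderiv ψ t)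
      = ∫ x in Ω, ∑ i, xd i (tderiv ψ) t x * xd i (tderiv ψ) t x := by
    simp only [sqGrad, normsq_gradient, xd]
  have eV : ∀ s, sqL2 Ω (tderiv ψ s) = ∫ x in Ω, tderiv ψ s x * tderiv ψ s x := fun s => by
    simp only [sqL2, sq]
  have hder := ((aV.hasDerivAt_integral t).const_mul (1/2)).add
    ((aG.hasDerivAt_integral t).const_mul (c ^ 2 / 2))
  simp only [eV, eG, eGv]
  refine hder.congr_deriv ?_
  -- the divergence terms
  let F : Fin d → ℝ → Spc d → ℝ := fun i t x =>
    c ^ 2 * (tderiv ψ t x * xd i ψ t x) + b * (tderiv ψ t x * xd i (tderiv ψ) t x)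
  have aF : ∀ i, Admissible Ω (F i) := fun i =>
    ((hv.mul (hadm.xd i)).cmul _).add ((hv.mul (hv.xd i)).cmul _)
  have hdiv : ∫ x in Ω, ∑ i, xd i (F i) t x = 0 := by
    rw [integral_finsetSum _ fun i _ => (((aF i).xd i).integrable t).integrableOn]
    exact Finset.sum_eq_zero fun i _ => (aF i).integral_xd i t
  have iDiv : Integrable (fun x => ∑ i, xd i (F i) t x) (volume.restrict Ω) :=
    ((Admissible.sum Finset.univ fun i => (aF i).xd i).integrable t).integrableOn
  have xF : ∀ i x, xd i (F i) t x
      = c ^ 2 * (tderiv ψ t x * xd i (xd i ψ) t x + xd i ψ t x * xd i (tderiv ψ) t x)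
        + b * (tderiv ψ t x * xd i (xd i (tderiv ψ)) t x
          + xd i (tderiv ψ) t x * xd i (tderiv ψ) t x) := by
    intro i x
    have h1 := (slice_diff hv.1 t x).hasFDerivAt
    have h2 := (slice_diff (hadm.xd i).1 t x).hasFDerivAt
    have h3 := (slice_diff (hv.xd i).1 t x).hasFDerivAt
    have h4 : HasFDerivAt (F i t) _ x := ((h1.mul h2).const_mul (c ^ 2)).add ((h1.mul h3).const_mul b)
    have h5 : xd i (F i) t x = fderiv ℝ (F i t) x (EuclideanSpace.single i 1) := rfl
    rw [h5, h4.fderiv]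
    simp [xd]
    ring
  have tV : ∀ x, tderiv (fun t x => tderiv ψ t x * tderiv ψ t x) t x
      = 2 * (tderiv ψ t x * tderiv (tderiv ψ) t x) := by
    intro x
    have h1 := smooth_hasDerivAt' hv.1 t x
    have h2 := (h1.mul h1).deriv
    refine Eq.trans h2 ?_
    ring
  have tG : ∀ x, tderiv (fun t x => ∑ i, xd i ψ t x * xd i ψ t x) t x
      = 2 * ∑ i, xd i ψ t x * xd i (tderiv ψ) t x := by
    intro x
    have h2 : HasDerivAt (fun s => ∑ i, xd i ψ s x * xd i ψ s x) _ t :=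
      HasDerivAt.fun_sum (u := Finset.univ) fun i _ =>
        (smooth_hasDerivAt' (hadm.xd i).1 t x).mul (smooth_hasDerivAt' (hadm.xd i).1 t x)
    refine Eq.trans h2.deriv ?_
    rw [Finset.mul_sum]
    refine Finset.sum_congr rfl fun i _ => ?_
    rw [tderiv_xd hadm.1]
    ring
  have iV := (aV.tderiv.integrable t).integrableOn (s := Ω)
  have iG := (aG.tderiv.integrable t).integrableOn (s := Ω)
  have iGv := (aGv.integrable t).integrableOn (s := Ω)
  -- pointwise identity on Ω
  have hpt : ∀ x ∈ Ω, blackF c k σ ψ t x * tderiv ψ t x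
      = (1/2 * tderiv (fun t x => tderiv ψ t x * tderiv ψ t x) t x
        + c ^ 2 / 2 * tderiv (fun t x => ∑ i, xd i ψ t x * xd i ψ t x) t x
        + b * ∑ i, xd i (tderiv ψ) t x * xd i (tderiv ψ) t x)
        - ∑ i, xd i (F i) t x := by
    intro x hx
    have hs := hsol t htI x hx
    have l1 : lap (ψ t) x = ∑ i, xd i (xd i ψ) t x := rfl
    have l2 : lap (tderiv ψ t) x = ∑ i, xd i (xd i (tderiv ψ)) t x := rfl
    rw [tV, tG]
    simp only [xF, Finset.sum_add_distrib, ← Finset.mul_sum]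
    rw [← l1, ← l2]
    unfold blackF
    linear_combination (-tderiv ψ t x) * hs
  rw [setIntegral_congr_fun hop.measurableSet hpt,
    integral_lin _ _ _ iV iG iGv iDiv, hdiv]
  ring
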